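/- With the notation below, let (φ_1,…,φ_𝒩) be an orthonormal basis of ℝ^𝒩, let N ≤ 𝒩, let {𝒫_1,…,𝒫_K} be a measurable partition of 𝒫 with k(μ) the unique index k with μ ∈ 𝒫_k, and let β_{i,k}^{min}, β_{i,k}^{max} be reals with β_{i,k}^{min} ≤ ⟨w_c(μ'), φ_i⟩ ≤ β_{i,k}^{max} for all μ' ∈ 𝒫_k, all 1 ≤ i ≤ N and 1 ≤ k ≤ K, where w_c(μ) = w(μ) − Z_d ũ_d(μ). Define β_i^{up}(μ) = β_{i,k(μ)}^{max} if ⟨r(μ),φ_i⟩ > 0 and β_{i,k(μ)}^{min} otherwise; β_i^{low}(μ) = β_{i,k(μ)}^{min} if ⟨r(μ),φ_i⟩ > 0 and β_{i,k(μ)}^{max} otherwise; T₁^{low}(μ) = Σ_{i=1}^N ⟨r(μ),φ_i⟩ β_i^{low}(μ); T₁^{up}(μ) = Σ_{i=1}^N ⟨r(μ),φ_i⟩ β_i^{up}(μ); T₁(μ) = max(|T₁^{low}(μ)|, |T₁^{up}(μ)|); and T₂ = E_μ[ |Σ_{i=N+1}^{𝒩} ⟨w_c(μ),φ_i⟩⟨r(μ),φ_i⟩|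 ], assumed finite, where μ is a random variable with values in 𝒫 and all the maps of μ appearing are measurable. Then for every α ∈ (0,1), P( |s(μ) − s̃_c(μ)| > T₁(μ) + T₂/α ) ≤ α. -/

import Mathlib

open Matrix MeasureTheory

/-- **Parseval's identity** for an orthonormal family of full cardinality. -/
theorem sum_dotProduct_mul_dotProduct {ι : Type*} [Fintype ι] [DecidableEq ι] {φ : ι → ι → ℝ}
    (hφ : ∀ i j, φ i ⬝ᵥ φ j = if i = j then (1 : ℝ) else 0) (a b : ι → ℝ) :
    ∑ i, (a ⬝ᵥ φ i) * (b ⬝ᵥ φ i) = a ⬝ᵥ b := by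
  have h : Matrix.of φ * (Matrix.of φ)ᵀ = 1 := by
    ext i j
    rw [Matrix.one_apply]
    exact hφ i j
  have h' := mul_eq_one_comm.mp h
  calc ∑ i, (a ⬝ᵥ φ i) * (b ⬝ᵥ φ i)
      = (Matrix.of φ *ᵥ a) ⬝ᵥ (Matrix.of φ *ᵥ b) :=
        Finset.sum_congr rfl fun i _ => by
          rw [dotProduct_comm a, dotProduct_comm b]
          rfl
    _ = a ⬝ᵥ b := by
        rw [← vecMul_transpose, ← dotProduct_mulVec, mulVec_mulVec, h', one_mulVec]

/-- **Markov's inequality**: a nonnegative integrable function exceeds its mean divided by `α`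
with probability at most `α`. -/
theorem measure_integral_div_lt_le {Ω : Type*} [MeasurableSpace Ω] {P : Measure Ω}
    [IsFiniteMeasure P] {g : Ω → ℝ} (hg : 0 ≤ g) (hint : Integrable g P) {α : ℝ} (hα : 0 < α) :
    P {ω | (∫ x, g x ∂P) / α < g ω} ≤ ENNReal.ofReal α := by
  rcases (integral_nonneg hg : 0 ≤ ∫ x, g x ∂P).eq_or_lt with h0 | hpos
  · have hae := (integral_eq_zero_iff_of_nonneg hg hint).mp h0.symm
    have hnull : P {ω | (∫ x, g x ∂P) / α < g ω} = 0 := by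
      refine measure_mono_null (fun ω hω => ?_) (ae_iff.mp hae)
      rw [Set.mem_ofPred_eq, ← h0, zero_div] at hω
      exact hω.ne'
    rw [hnull]
    exact zero_le
  · have hM := mul_meas_ge_le_integral_of_nonneg (.of_forall hg) hint ((∫ x, g x ∂P) / α)
    rw [div_mul_eq_mul_div, div_le_iff₀ hα] at hM
    have hsub : {ω | (∫ x, g x ∂P) / α < g ω} ⊆ {ω | (∫ x, g x ∂P) / α ≤ g ω} :=
      Set.ofPred_subset_ofPred.mpr fun _ => le_of_lt
    refine (measure_mono hsub).trans ?_
    exact (ENNReal.le_ofReal_iff_toReal_le (measure_ne_top _ _) hα.le).mpr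
      (le_of_mul_le_mul_left hM hpos)

/-- A sum of products whose second factors are bracketed lies, in absolute value, below the larger
of the two extremal sums. -/
theorem abs_sum_mul_le_max {ι : Type*} (t : Finset ι) (x y m M : ι → ℝ)
    (h : ∀ i ∈ t, m i ≤ y i ∧ y i ≤ M i) :
    |∑ i ∈ t, x i * y i| ≤
      max |∑ i ∈ t, x i * (if 0 < x i then m i else M i)|
        |∑ i ∈ t, x i * (if 0 < x i then M i else m i)| := by
  refine abs_le_max_abs_abs (Finset.sum_le_sum fun i hi => ?_) (Finset.sum_le_sum fun i hi => ?_)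
  all_goals
    obtain ⟨h1, h2⟩ := h i hi
    split_ifs with hx
    · gcongr
    · exact mul_le_mul_of_nonpos_left ‹_› (not_lt.mp hx)

/-- The output error equals minus the pairing of the adjoint solution with the residual. -/
theorem dotProduct_inv_mulVec_sub {ι : Type*} [Fintype ι] [DecidableEq ι] {A : Matrix ι ι ℝ}
    (hA : IsUnit A) (l f v : ι → ℝ) :
    l ⬝ᵥ (A⁻¹ *ᵥ f) - l ⬝ᵥ v = -((Aᵀ⁻¹ *ᵥ l) ⬝ᵥ (A *ᵥ v - f)) := by
  have hdet := (isUnit_iff_isUnit_det A).mp hA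
  rw [← transpose_nonsing_inv, mulVec_transpose, ← dotProduct_mulVec, mulVec_sub, mulVec_mulVec,
    nonsing_inv_mul _ hdet, one_mulVec, dotProduct_sub, neg_sub]

/-- the goal-oriented probabilistic error bound for the corrected
output: P( |s(μ) − s̃_c(μ)| > T₁(μ) + T₂/α ) ≤ α for every risk level α ∈ (0,1),
where the brackets now bound ⟨w_c(μ'), φ_i⟩ with w_c(μ) = w(μ) − Z_d ũ_d(μ). -/
theorem stmt_15 {𝒩 n nd K N : ℕ} (hN1 : 1 ≤ 𝒩) (hNN : N ≤ 𝒩) (hK : 1 ≤ K)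
    {Pa : Type*} [MeasurableSpace Pa]
    {Ω : Type*} [MeasureSpace Ω] [IsProbabilityMeasure (volume : Measure Ω)]
    (μv : Ω → Pa) (hμv : Measurable μv)
    (A : Pa → Matrix (Fin 𝒩) (Fin 𝒩) ℝ) (f : Pa → (Fin 𝒩 → ℝ))
    (l : Fin 𝒩 → ℝ) (Z : Matrix (Fin 𝒩) (Fin n) ℝ)
    (Zd : Matrix (Fin 𝒩) (Fin nd) ℝ)
    (hA : ∀ p, IsUnit (A p)) (hAZ : ∀ p, IsUnit (Zᵀ * A p * Z))
    (hAZd : ∀ p, IsUnit (Zdᵀ * (A p)ᵀ * Zd))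
    (u : Pa → (Fin 𝒩 → ℝ)) (ut : Pa → (Fin n → ℝ)) (utd : Pa → (Fin nd → ℝ))
    (w wc r : Pa → (Fin 𝒩 → ℝ)) (s st stc : Pa → ℝ)
    (hu : ∀ p, u p = (A p)⁻¹ *ᵥ f p)
    (hut : ∀ p, (Zᵀ * A p * Z) *ᵥ ut p = Zᵀ *ᵥ f p)
    (hutd : ∀ p, (Zdᵀ * (A p)ᵀ * Zd) *ᵥ utd p = Zdᵀ *ᵥ l)
    (hw : ∀ p, w p = ((A p)ᵀ)⁻¹ *ᵥ l)
    (hwc : ∀ p, wc p = w p - Zd *ᵥ utd p)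
    (hr : ∀ p, r p = A p *ᵥ (Z *ᵥ ut p) - f p)
    (hs : ∀ p, s p = l ⬝ᵥ u p)
    (hst : ∀ p, st p = l ⬝ᵥ (Z *ᵥ ut p))
    (hstc : ∀ p, stc p = st p - (Zd *ᵥ utd p) ⬝ᵥ r p)
    -- orthonormal basis of ℝ^𝒩
    (φ : Fin 𝒩 → (Fin 𝒩 → ℝ))
    (hφ : ∀ i j, φ i ⬝ᵥ φ j = if i = j then (1 : ℝ) else 0)
    -- measurable partition of the parameter set
    (Pk : Fin K → Set Pa) (hPmeas : ∀ k, MeasurableSet (Pk k))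
    (hPcov : ∀ p, ∃ k, p ∈ Pk k)
    (hPdisj : ∀ k k', k ≠ k' → Disjoint (Pk k) (Pk k'))
    (kof : Pa → Fin K) (hkof : ∀ p, p ∈ Pk (kof p))
    -- bracketing bounds on ⟨w_c(μ'), φ_i⟩ on each cell of the partition
    (βmin βmax : Fin 𝒩 → Fin K → ℝ)
    (hβ : ∀ i : Fin 𝒩, (i : ℕ) < N → ∀ k, ∀ p ∈ Pk k,
      βmin i k ≤ wc p ⬝ᵥ φ i ∧ wc p ⬝ᵥ φ i ≤ βmax i k)
    -- the computable first-order term T₁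
    (T₁ : Pa → ℝ)
    (hT₁ : ∀ p, T₁ p =
      max |∑ i ∈ Finset.univ.filter (fun i : Fin 𝒩 => (i : ℕ) < N),
             (r p ⬝ᵥ φ i) *
               (if 0 < r p ⬝ᵥ φ i then βmin i (kof p) else βmax i (kof p))|
          |∑ i ∈ Finset.univ.filter (fun i : Fin 𝒩 => (i : ℕ) < N),
             (r p ⬝ᵥ φ i) *
               (if 0 < r p ⬝ᵥ φ i then βmax i (kof p) else βmin i (kof p))|)
    -- the mean absolute tail term T₂, assumed finite
    (T₂ : ℝ)
    (hT₂ : T₂ = ∫ ω, |∑ i ∈ Finset.univ.filter (fun i : Fin 𝒩 => N ≤ (i : ℕ)),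
        (wc (μv ω) ⬝ᵥ φ i) * (r (μv ω) ⬝ᵥ φ i)|)
    (hInt : Integrable (fun ω =>
        |∑ i ∈ Finset.univ.filter (fun i : Fin 𝒩 => N ≤ (i : ℕ)),
          (wc (μv ω) ⬝ᵥ φ i) * (r (μv ω) ⬝ᵥ φ i)|))
    -- measurability of the maps of μ appearing in the statement
    (hmeas1 : Measurable (fun ω => T₁ (μv ω)))
    (hmeas2 : Measurable (fun ω => s (μv ω) - stc (μv ω)))
    (α : ℝ) (hα : 0 < α) (hα1 : α < 1) :
    volume {ω | T₁ (μv ω) + T₂ / α < |s (μv ω) - stc (μv ω)|} ≤ ENNReal.ofReal α := by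
  have hpt : ∀ p, |s p - stc p| ≤ T₁ p +
      |∑ i ∈ Finset.univ.filter (fun i : Fin 𝒩 => N ≤ (i : ℕ)),
        (wc p ⬝ᵥ φ i) * (r p ⬝ᵥ φ i)| := by
    intro p
    have herr : s p - stc p = -(wc p ⬝ᵥ r p) := by
      have h := dotProduct_inv_mulVec_sub (hA p) l (f p) (Z *ᵥ ut p)
      rw [← hu, ← hw, ← hr, ← hs, ← hst] at h
      rw [hstc, hwc, sub_dotProduct]
      linarith
    have hfilter : Finset.univ.filter (fun i : Fin 𝒩 => N ≤ (i : ℕ)) =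
        Finset.univ.filter (fun i : Fin 𝒩 => ¬ (i : ℕ) < N) := by
      simp only [not_lt]
    have hhead := abs_sum_mul_le_max (Finset.univ.filter (fun i : Fin 𝒩 => (i : ℕ) < N))
      (fun i => r p ⬝ᵥ φ i) (fun i => wc p ⬝ᵥ φ i) (fun i => βmin i (kof p))
      (fun i => βmax i (kof p))
      fun i hi => hβ i (Finset.mem_filter.mp hi).2 (kof p) p (hkof p)
    rw [← hT₁] at hhead
    simp only [mul_comm (r p ⬝ᵥ φ _)] at hhead
    rw [herr, abs_neg, ← sum_dotProduct_mul_dotProduct hφ (wc p) (r p),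
      ← Finset.sum_filter_add_sum_filter_not Finset.univ (fun i : Fin 𝒩 => (i : ℕ) < N), hfilter]
    exact (abs_add_le _ _).trans (by gcongr)
  refine le_trans (measure_mono fun ω hω => ?_)
    (measure_integral_div_lt_le (fun ω => abs_nonneg _) hInt hα)
  rw [Set.mem_ofPred_eq] at hω
  rw [Set.mem_ofPred_eq, ← hT₂]
  linarith [hpt (μv ω)]
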